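/- arXiv:1208.1007 — 2 statements merged into one kernel-verified Lean document; each statement's English description precedes it below -/
import Mathlib

section
/- Let $q$ be an odd prime power. The order of the special orthogonal group $\mathrm{SO}_{2n+1}(\mathbb{F}_q)$ of a non-degenerate quadratic space of dimension $2n+1$ over $\mathbb{F}_q$ is $q^{n^2}(q^{2n}-1)(q^{2n-2}-1)\cdots(q^2-1)$. -/
open Module

namespace LinearMap.BilinForm

section General

variable {F V : Type*} [Field F] [AddCommGroup V] [Module F V]

/-- The group of linear automorphisms preserving a bilinear form. -/
def isometryGroup (B : LinearMap.BilinForm F V) : Subgroup (V ≃ₗ[F] V) where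
  carrier := {g | ∀ v w, B (g v) (g w) = B v w}
  mul_mem' {a b} ha hb v w := by
    simp only [LinearEquiv.mul_apply]
    rw [ha, hb]
  one_mem' _ _ := rfl
  inv_mem' {a} ha v w := by
    rw [← ha]
    congr 1
    · exact congrArg _ (a.apply_symm_apply v)
    · exact a.apply_symm_apply w

/-- The reflection in the hyperplane orthogonal to an anisotropic vector is an isometry. -/
theorem exists_mem_isometryGroup_reflection {B : LinearMap.BilinForm F V} (hs : B.IsSymm) {a : V}
    (ha : B a a ≠ 0) :
    ∃ g ∈ B.isometryGroup, ∀ y, g y = y - (2 * B a y / B a a) • a := by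
  have hf : ((2 / B a a) • B a : Dual F V) a = 2 := by
    simp [ha]
  have happ (y : V) : reflection hf y = y - (2 * B a y / B a a) • a := by
    rw [reflection_apply]
    simp [div_mul_eq_mul_div]
  refine ⟨reflection hf, fun v w => ?_, happ⟩
  simp only [happ, map_sub, map_smul, LinearMap.sub_apply, LinearMap.smul_apply, smul_eq_mul]
  rw [hs.eq v a]
  field_simp
  ring

/-- Two vectors of equal nonzero length are related by an isometry fixing every vector orthogonal
to both. -/
theorem exists_mem_isometryGroup_map_eq {B : LinearMap.BilinForm F V} (hs : B.IsSymm)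
    (h2 : (2 : F) ≠ 0) {v w : V} (hv : B v v ≠ 0) (hvw : B v v = B w w) :
    ∃ g ∈ B.isometryGroup, g v = w ∧ ∀ u, B v u = 0 → B w u = 0 → g u = u := by
  by_cases h : B (v - w) (v - w) = 0
  · have hw : B w w ≠ 0 := hvw ▸ hv
    have hp : B (v + w) (v + w) ≠ 0 := by
      intro h'
      have : 2 * 2 * B v v = 0 := by
        simp only [map_sub, map_add, LinearMap.sub_apply, LinearMap.add_apply] at h h'
        linear_combination h + h' + 2 * hvw
      exact hv (by simpa [h2] using this)
    obtain ⟨g₁, hg₁, e₁⟩ := exists_mem_isometryGroup_reflection hs hp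
    obtain ⟨g₂, hg₂, e₂⟩ := exists_mem_isometryGroup_reflection hs hw
    refine ⟨g₂ * g₁, mul_mem hg₂ hg₁, ?_, fun u hu hu' => ?_⟩
    · have h1 : 2 * B (v + w) v / B (v + w) (v + w) = 1 := by
        rw [div_eq_one_iff_eq hp]
        simp only [map_add, LinearMap.add_apply]
        rw [hs.eq w v]
        linear_combination hvw
      rw [LinearEquiv.mul_apply, e₁, h1, e₂]
      have h3 : v - (1 : F) • (v + w) = -w := by simp
      rw [h3, map_neg, mul_neg, neg_div, mul_div_cancel_right₀ _ hw]
      module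
    · rw [LinearEquiv.mul_apply, e₁, e₂]
      simp [hu, hu']
  · obtain ⟨g, hg, e⟩ := exists_mem_isometryGroup_reflection hs h
    refine ⟨g, hg, ?_, fun u hu hu' => ?_⟩
    · have h1 : 2 * B (v - w) v / B (v - w) (v - w) = 1 := by
        rw [div_eq_one_iff_eq h]
        simp only [map_sub, LinearMap.sub_apply]
        rw [hs.eq w v]
        linear_combination hvw
      rw [e, h1]
      simp
    · rw [e]
      simp [hu, hu']

/-- A pair of isotropic vectors spanning a hyperbolic plane. -/
structure IsHyperbolicPair (B : LinearMap.BilinForm F V) (e f : V) : Prop where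
  left : B e e = 0
  right : B f f = 0
  pair : B e f = 1

/-- The subspace of vectors orthogonal to both `e` and `f`. -/
def pairCompl (B : LinearMap.BilinForm F V) (e f : V) : Submodule F V :=
  LinearMap.ker (B e) ⊓ LinearMap.ker (B f)

theorem mem_pairCompl {B : LinearMap.BilinForm F V} {e f x : V} :
    x ∈ B.pairCompl e f ↔ B e x = 0 ∧ B f x = 0 := by
  simp [pairCompl]

namespace IsHyperbolicPair

variable {B : LinearMap.BilinForm F V} {e f : V}

/-- A hyperbolic plane splits off as an orthogonal direct summand. -/
def decomp (h : B.IsHyperbolicPair e f) (hs : B.IsSymm) : V ≃ₗ[F] F × F × B.pairCompl e f where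
  toFun x := (B f x, B e x, ⟨x - B f x • e - B e x • f, by
    have := hs.eq f e
    simp [mem_pairCompl, h.left, h.right, h.pair, this]⟩)
  invFun p := p.1 • e + p.2.1 • f + p.2.2
  map_add' x y := by
    ext
    · simp
    · simp
    · simp only [map_add, Prod.mk_add_mk, Submodule.coe_add]
      module
  map_smul' c x := by
    ext
    · simp
    · simp
    · simp only [map_smul, Prod.smul_mk, Submodule.coe_smul, RingHom.id_apply, smul_eq_mul]
      module
  left_inv x := by simp
  right_inv := by
    rintro ⟨a, b, w, hw⟩
    obtain ⟨h1, h2⟩ := mem_pairCompl.1 hw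
    have := hs.eq f e
    ext
    · simp [h2, h.right, h.pair, this]
    · simp [h1, h.left, h.pair]
    · simp only [map_add, map_smul, smul_eq_mul, h1, h2, h.left, h.right, h.pair, this]
      module

theorem decomp_symm_apply (h : B.IsHyperbolicPair e f) (hs : B.IsSymm)
    (p : F × F × B.pairCompl e f) :
    (h.decomp hs).symm p = p.1 • e + p.2.1 • f + p.2.2 := rfl

theorem decomp_apply_snd_fst (h : B.IsHyperbolicPair e f) (hs : B.IsSymm) (x : V) :
    (h.decomp hs x).2.1 = B e x := rfl

theorem apply_decomp_symm (h : B.IsHyperbolicPair e f) (hs : B.IsSymm)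
    (p q : F × F × B.pairCompl e f) :
    B ((h.decomp hs).symm p) ((h.decomp hs).symm q) =
      p.1 * q.2.1 + p.2.1 * q.1 + B.restrict (B.pairCompl e f) p.2.2 q.2.2 := by
  obtain ⟨a, b, w, hw⟩ := p
  obtain ⟨a', b', w', hw'⟩ := q
  obtain ⟨h1, h2⟩ := mem_pairCompl.1 hw
  obtain ⟨h1', h2'⟩ := mem_pairCompl.1 hw'
  have h3 := hs.eq f e
  have h4 := hs.eq w e
  have h5 := hs.eq w f
  simp [decomp_symm_apply, h1, h2, h1', h2', h3, h4, h5, h.left, h.right, h.pair,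
    restrict_apply]

theorem separatingLeft_restrict (h : B.IsHyperbolicPair e f) (hs : B.IsSymm)
    (hB : B.SeparatingLeft) : (B.restrict (B.pairCompl e f)).SeparatingLeft := by
  intro x hx
  have := hB ((h.decomp hs).symm (0, 0, x)) fun y => by
    obtain ⟨q, rfl⟩ := (h.decomp hs).symm.surjective y
    rw [apply_decomp_symm, hx]
    simp
  simpa using this

theorem finrank_pairCompl [FiniteDimensional F V] (h : B.IsHyperbolicPair e f) (hs : B.IsSymm) :
    finrank F V = finrank F (B.pairCompl e f) + 2 := by
  rw [(h.decomp hs).finrank_eq, finrank_prod, finrank_prod, finrank_self]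
  ring

/-- Isometries act transitively on hyperbolic pairs. -/
theorem exists_mem_isometryGroup (hs : B.IsSymm) (h2 : (2 : F) ≠ 0)
    (h : B.IsHyperbolicPair e f) {e' f' : V} (h' : B.IsHyperbolicPair e' f') :
    ∃ g ∈ B.isometryGroup, g e = e' ∧ g f = f' := by
  have key {x y : V} (hp : B.IsHyperbolicPair x y) :
      B (x + y) (x + y) = 2 ∧ B (x - y) (x - y) = -2 ∧ B (x + y) (x - y) = 0 := by
    have := hs.eq y x
    simp only [map_add, map_sub, LinearMap.add_apply, LinearMap.sub_apply, hp.left, hp.right,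
      hp.pair, this]
    refine ⟨by ring, by ring, by ring⟩
  obtain ⟨k1, k2, k3⟩ := key h
  obtain ⟨k1', k2', k3'⟩ := key h'
  obtain ⟨g, hg, hgv, -⟩ := exists_mem_isometryGroup_map_eq hs h2 (by rwa [k1]) (k1.trans k1'.symm)
  have hgw : B (g (e - f)) (g (e - f)) = -2 := by rw [hg, k2]
  obtain ⟨r, hr, hrw, hrf⟩ := exists_mem_isometryGroup_map_eq hs h2
    (by rw [hgw]; exact neg_ne_zero.2 h2) (hgw.trans k2'.symm)
  have hrv : r (e' + f') = e' + f' := by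
    refine hrf _ ?_ ?_
    · rw [← hgv, hg, hs.eq, k3]
    · rw [hs.eq, k3']
  have e1 : r (g e) + r (g f) = e' + f' := by rw [← map_add, ← map_add, hgv, hrv]
  have e2 : r (g e) - r (g f) = e' - f' := by rw [← map_sub, ← map_sub, hrw]
  refine ⟨r * g, mul_mem hr hg, ?_, ?_⟩
  · refine smul_right_injective V h2 ?_
    change (2 : F) • r (g e) = (2 : F) • e'
    linear_combination (norm := module) e1 + e2
  · refine smul_right_injective V h2 ?_
    change (2 : F) • r (g f) = (2 : F) • f'
    linear_combination (norm := module) e1 - e2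

/-- The stabilizer of a hyperbolic pair is the isometry group of its orthogonal complement. -/
theorem card_stabilizer (h : B.IsHyperbolicPair e f) (hs : B.IsSymm) :
    Nat.card (MulAction.stabilizer B.isometryGroup (e, f)) =
      Nat.card (B.restrict (B.pairCompl e f)).isometryGroup := by
  have hfix (g : MulAction.stabilizer B.isometryGroup (e, f)) :
      g.1.1 e = e ∧ g.1.1 f = f := Prod.ext_iff.1 g.2
  have hmem (g : V ≃ₗ[F] V) (hg : g ∈ B.isometryGroup) (he : g e = e) (hf : g f = f) (x : V)
      (hx : x ∈ B.pairCompl e f) : g x ∈ B.pairCompl e f := by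
    rw [mem_pairCompl] at hx ⊢
    rwa [← hg, ← hg f, he, hf] at hx
  let extend (k : B.pairCompl e f ≃ₗ[F] B.pairCompl e f) : V ≃ₗ[F] V :=
    (h.decomp hs).trans (((LinearEquiv.refl F F).prodCongr
      ((LinearEquiv.refl F F).prodCongr k)).trans (h.decomp hs).symm)
  have hext (k : B.pairCompl e f ≃ₗ[F] B.pairCompl e f) (p : F × F × B.pairCompl e f) :
      extend k ((h.decomp hs).symm p) = (h.decomp hs).symm (p.1, p.2.1, k p.2.2) := by
    simp [extend]
  have he : e = (h.decomp hs).symm (1, 0, 0) := by simp [decomp_symm_apply]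
  have hf : f = (h.decomp hs).symm (0, 1, 0) := by simp [decomp_symm_apply]
  have hw (x : B.pairCompl e f) : (x : V) = (h.decomp hs).symm (0, 0, x) := by
    simp [decomp_symm_apply]
  have hiso (k : (B.restrict (B.pairCompl e f)).isometryGroup) : extend k ∈ B.isometryGroup := by
    intro v w
    obtain ⟨p, rfl⟩ := (h.decomp hs).symm.surjective v
    obtain ⟨q, rfl⟩ := (h.decomp hs).symm.surjective w
    rw [hext, hext, apply_decomp_symm, apply_decomp_symm, k.2]
  symm
  refine Nat.card_congr (Equiv.ofBijective (fun k => ⟨⟨extend k, hiso k⟩, ?_⟩) ⟨?_, ?_⟩)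
  · refine Prod.ext ?_ ?_
    · change extend k e = e
      refine (congrArg _ he).trans ?_
      rw [hext]
      simp [decomp_symm_apply]
    · change extend k f = f
      refine (congrArg _ hf).trans ?_
      rw [hext]
      simp [decomp_symm_apply]
  · intro k l hkl
    have hkl' : extend k = extend l := congrArg (fun g => g.1.1) hkl
    ext x
    have := DFunLike.congr_fun hkl' (x : V)
    rw [hw, hext, hext] at this
    simpa [decomp_symm_apply] using this
  · intro g
    obtain ⟨hge, hgf⟩ := hfix g
    obtain ⟨hie, hif⟩ := hfix g⁻¹
    let k : B.pairCompl e f ≃ₗ[F] B.pairCompl e f := LinearEquiv.ofLinearMap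
      (g.1.1.toLinearMap.restrict (hmem g.1.1 g.1.2 hge hgf))
      (g⁻¹.1.1.toLinearMap.restrict (hmem g⁻¹.1.1 g⁻¹.1.2 hie hif))
      (by ext x; exact g.1.1.apply_symm_apply (x : V))
      (by ext x; exact g.1.1.symm_apply_apply (x : V))
    refine ⟨⟨k, fun v w => g.1.2 v w⟩, ?_⟩
    ext v
    change extend k v = g.1.1 v
    obtain ⟨p, rfl⟩ := (h.decomp hs).symm.surjective v
    rw [hext, decomp_symm_apply, decomp_symm_apply, map_add, map_add, map_smul, map_smul, hge, hgf]
    rfl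

/-- Isotropic vectors counted along the splitting off of a hyperbolic plane. -/
theorem card_isotropic [Finite F] [FiniteDimensional F V] (h : B.IsHyperbolicPair e f)
    (hs : B.IsSymm) (h2 : (2 : F) ≠ 0) :
    Nat.card {x // B x x = 0} = (Nat.card F - 1) * Nat.card (B.pairCompl e f) +
      Nat.card F * Nat.card {w // B.restrict (B.pairCompl e f) w w = 0} := by
  have : Finite V := Module.finite_of_finite F
  set C := B.restrict (B.pairCompl e f)
  rw [← Nat.card_units, ← Nat.card_prod, ← Nat.card_prod, ← Nat.card_sum]
  symm
  refine Nat.card_congr (Equiv.ofBijective (Sum.elim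
    (fun p => ⟨(h.decomp hs).symm (-(C p.2 p.2) / (2 * p.1), p.1, p.2), ?_⟩)
    (fun p => ⟨(h.decomp hs).symm (p.1, 0, p.2), ?_⟩)) ⟨?_, ?_⟩)
  · rw [apply_decomp_symm]
    change _ + _ + C p.2 p.2 = 0
    have := p.1.ne_zero
    field_simp
    ring
  · rw [apply_decomp_symm]
    change _ + _ + C p.2 p.2 = 0
    rw [p.2.2]
    simp
  · rintro (⟨b, w⟩ | ⟨a, w⟩) (⟨b', w'⟩ | ⟨a', w'⟩) heq
    all_goals
      simp only [Sum.elim_inl, Sum.elim_inr, Subtype.mk.injEq, EmbeddingLike.apply_eq_iff_eq,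
        Prod.mk.injEq] at heq
    · obtain ⟨-, h1, rfl⟩ := heq
      rw [Units.ext h1]
    · exact (b.ne_zero heq.2.1).elim
    · exact (b'.ne_zero heq.2.1.symm).elim
    · obtain ⟨rfl, -, h1⟩ := heq
      rw [Subtype.ext h1]
  · rintro ⟨x, hx⟩
    obtain ⟨⟨a, b, w⟩, rfl⟩ := (h.decomp hs).symm.surjective x
    rw [apply_decomp_symm] at hx
    change a * b + b * a + C w w = 0 at hx
    by_cases hb : b = 0
    · subst hb
      exact ⟨Sum.inr (a, ⟨w, by simpa using hx⟩), rfl⟩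
    · refine ⟨Sum.inl (Units.mk0 b hb, w), ?_⟩
      have : -(C w w) / (2 * b) = a := by
        field_simp
        linear_combination -hx
      simp [this]

/-- The number of ways to complete a vector to a hyperbolic pair. -/
theorem card_partners (h : B.IsHyperbolicPair e f) (hs : B.IsSymm) (h2 : (2 : F) ≠ 0) :
    Nat.card {y // B.IsHyperbolicPair e y} = Nat.card (B.pairCompl e f) := by
  set C := B.restrict (B.pairCompl e f)
  symm
  refine Nat.card_congr (Equiv.ofBijective
    (fun w => ⟨(h.decomp hs).symm (-(C w w) / 2, 1, w), h.left, ?_, ?_⟩) ⟨?_, ?_⟩)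
  · rw [apply_decomp_symm]
    change _ + _ + C w w = 0
    field_simp
    ring
  · rw [← decomp_apply_snd_fst h hs, LinearEquiv.apply_symm_apply]
  · intro w w' heq
    simp only [Subtype.mk.injEq, EmbeddingLike.apply_eq_iff_eq, Prod.mk.injEq] at heq
    exact heq.2.2
  · rintro ⟨x, hx⟩
    obtain ⟨⟨a, b, w⟩, rfl⟩ := (h.decomp hs).symm.surjective x
    have hb : b = 1 := by
      rw [← hx.pair, ← decomp_apply_snd_fst h hs, LinearEquiv.apply_symm_apply]
    subst hb
    have hx' := hx.right
    rw [apply_decomp_symm] at hx'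
    change a * 1 + 1 * a + C w w = 0 at hx'
    have : -(C w w) / 2 = a := by
      field_simp
      linear_combination -hx'
    exact ⟨w, by simp [this]⟩

/-- Orbit-stabilizer for the action of the isometry group on hyperbolic pairs. -/
theorem card_isometryGroup (h : B.IsHyperbolicPair e f) (hs : B.IsSymm) (h2 : (2 : F) ≠ 0) :
    Nat.card B.isometryGroup = Nat.card {p : V × V // B.IsHyperbolicPair p.1 p.2} *
      Nat.card (B.restrict (B.pairCompl e f)).isometryGroup := by
  have horb : MulAction.orbit B.isometryGroup (e, f) = {p | B.IsHyperbolicPair p.1 p.2} := by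
    ext ⟨e', f'⟩
    constructor
    · rintro ⟨g, hg⟩
      obtain ⟨rfl, rfl⟩ := Prod.ext_iff.1 hg
      exact ⟨(g.2 e e).trans h.left, (g.2 f f).trans h.right, (g.2 e f).trans h.pair⟩
    · intro h'
      obtain ⟨g, hg, he, hf⟩ := h.exists_mem_isometryGroup hs h2 h'
      exact ⟨⟨g, hg⟩, Prod.ext he hf⟩
  rw [← card_stabilizer h hs,
    ← Subgroup.card_mul_index (MulAction.stabilizer B.isometryGroup (e, f)),
    MulAction.index_stabilizer, horb, mul_comm]
  rfl

/-- A nonzero isotropic vector belongs to a hyperbolic pair. -/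
theorem exists_of_isotropic (hs : B.IsSymm) (hB : B.SeparatingLeft) (h2 : (2 : F) ≠ 0)
    (he : e ≠ 0) (hee : B e e = 0) : ∃ f, B.IsHyperbolicPair e f := by
  obtain ⟨y, hy⟩ : ∃ y, B e y ≠ 0 := by
    by_contra! hcon
    exact he (hB e hcon)
  set z := (B e y)⁻¹ • y with hz
  have hez : B e z = 1 := by simp [hz, hy]
  have hze : B z e = 1 := by rw [hs.eq, hez]
  refine ⟨z - (B z z / 2) • e, hee, ?_, ?_⟩
  · simp only [map_sub, map_smul, LinearMap.sub_apply, LinearMap.smul_apply, smul_eq_mul, hez,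
      hze, hee]
    field_simp
    ring
  · simp [hez, hee]

theorem card_hyperbolicPairs [Finite F] [FiniteDimensional F V] (hs : B.IsSymm)
    (hB : B.SeparatingLeft) (h2 : (2 : F) ≠ 0) :
    Nat.card {p : V × V // B.IsHyperbolicPair p.1 p.2} =
      (Nat.card {x // B x x = 0} - 1) * Nat.card F ^ (finrank F V - 2) := by
  have : Finite V := Module.finite_of_finite F
  have : Fintype V := Fintype.ofFinite V
  classical
  let E : {p : V × V // B.IsHyperbolicPair p.1 p.2} ≃
      Σ e : {x : {x // B x x = 0} // x ≠ ⟨0, by simp⟩}, {f // B.IsHyperbolicPair e.1.1 f} :=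
    { toFun := fun p => ⟨⟨⟨p.1.1, p.2.left⟩, fun h0 => by
        have h1 : p.1.1 = 0 := congrArg Subtype.val h0
        have := p.2.pair
        simp [h1] at this⟩, p.1.2, p.2⟩
      invFun := fun s => ⟨(s.1.1.1, s.2.1), s.2.2⟩
      left_inv := fun _ => rfl
      right_inv := fun _ => rfl }
  have hfib (x : {x : {x // B x x = 0} // x ≠ ⟨0, by simp⟩}) :
      Nat.card {f // B.IsHyperbolicPair x.1.1 f} = Nat.card F ^ (finrank F V - 2) := by
    obtain ⟨f, hf⟩ := exists_of_isotropic hs hB h2 (fun h0 => x.2 (Subtype.ext h0)) x.1.2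
    rw [card_partners hf hs h2, Module.natCard_eq_pow_finrank (K := F), finrank_pairCompl hf hs,
      Nat.add_sub_cancel]
  rw [Nat.card_congr E, Nat.card_sigma, Finset.sum_congr rfl fun x _ => hfib x]
  simp [Fintype.card_subtype_compl]

end IsHyperbolicPair

theorem SeparatingLeft.exists_self_ne_zero [Nontrivial V] {B : LinearMap.BilinForm F V}
    (hs : B.IsSymm) (hB : B.SeparatingLeft) (h2 : (2 : F) ≠ 0) : ∃ v, B v v ≠ 0 := by
  by_contra! hcon
  obtain ⟨x, hx⟩ := exists_ne (0 : V)
  refine hx (hB x fun y => ?_)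
  have h1 := hcon (x + y)
  simp only [map_add, LinearMap.add_apply, hcon, hs.eq y x] at h1
  have : 2 * B x y = 0 := by linear_combination h1
  simpa [h2] using this

/-- A non-degenerate symmetric form in dimension at least three over a finite field of odd
characteristic has a nonzero isotropic vector. -/
theorem SeparatingLeft.exists_isotropic [Finite F] [FiniteDimensional F V]
    {B : LinearMap.BilinForm F V} (hs : B.IsSymm) (hB : B.SeparatingLeft) (h2 : (2 : F) ≠ 0)
    (hV : 2 < finrank F V) : ∃ e, e ≠ 0 ∧ B e e = 0 := by
  have : Fintype F := Fintype.ofFinite F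
  have : Nontrivial V := Module.nontrivial_of_finrank_pos (R := F) (by lia)
  obtain ⟨v, hv⟩ := SeparatingLeft.exists_self_ne_zero hs hB h2
  have hker (u : V) : ∃ w, w ≠ 0 ∧ B v w = 0 ∧ B u w = 0 := by
    have := LinearMap.ker_ne_bot_of_finrank_lt (f := (B v).prod (B u)) (by simpa using hV)
    obtain ⟨w, hw, hw0⟩ := Submodule.exists_mem_ne_zero_of_ne_bot this
    exact ⟨w, hw0, by simpa using hw⟩
  obtain ⟨u, hu0, hvu, -⟩ := hker v
  obtain ⟨w, hw0, hvw, huw⟩ := hker u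
  by_cases huu : B u u = 0
  · exact ⟨u, hu0, huu⟩
  by_cases hww : B w w = 0
  · exact ⟨w, hw0, hww⟩
  obtain ⟨a, b, hab⟩ := FiniteField.exists_root_sum_quadratic
    (f := Polynomial.C (B u u) * Polynomial.X ^ 2 + Polynomial.C 0 * Polynomial.X +
      Polynomial.C (B v v))
    (g := Polynomial.C (B w w) * Polynomial.X ^ 2 + Polynomial.C 0 * Polynomial.X +
      Polynomial.C 0)
    (Polynomial.degree_quadratic huu) (Polynomial.degree_quadratic hww)
    (FiniteField.odd_card_of_char_ne_two fun hc => h2 (by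
      have := CharP.cast_eq_zero F (ringChar F)
      simpa [hc] using this))
  refine ⟨v + a • u + b • w, fun h0 => hv ?_, ?_⟩
  · simpa [hvu, hvw] using congrArg (B v) h0
  · have h3 := hs.eq u v
    have h4 := hs.eq w v
    have h5 := hs.eq w u
    simp only [Polynomial.eval_add, Polynomial.eval_mul, Polynomial.eval_C, Polynomial.eval_pow,
      Polynomial.eval_X] at hab
    simp only [map_add, map_smul, LinearMap.add_apply, LinearMap.smul_apply, smul_eq_mul,
      h3, h4, h5, hvu, hvw, huw]
    linear_combination hab

end General

theorem exists_isHyperbolicPair {F V : Type*} [Field F] [Finite F] [AddCommGroup V] [Module F V]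
    [FiniteDimensional F V] {B : LinearMap.BilinForm F V} (hs : B.IsSymm) (hB : B.SeparatingLeft)
    (h2 : (2 : F) ≠ 0) (hV : 2 < finrank F V) : ∃ e f, B.IsHyperbolicPair e f := by
  obtain ⟨e, he, hee⟩ := SeparatingLeft.exists_isotropic hs hB h2 hV
  exact ⟨e, IsHyperbolicPair.exists_of_isotropic hs hB h2 he hee⟩

/-- The number of isotropic vectors in odd dimension. -/
theorem card_isotropic_of_odd_finrank {F V : Type*} [Field F] [Finite F] [AddCommGroup V]
    [Module F V] [FiniteDimensional F V] (h2 : (2 : F) ≠ 0) {B : LinearMap.BilinForm F V}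
    (hs : B.IsSymm) (hB : B.SeparatingLeft) {n : ℕ} (hV : finrank F V = 2 * n + 1) :
    Nat.card {x // B x x = 0} = Nat.card F ^ (2 * n) := by
  induction n generalizing V with
  | zero =>
    have : Nontrivial V := Module.nontrivial_of_finrank_pos (R := F) (by lia)
    obtain ⟨v, hv⟩ := SeparatingLeft.exists_self_ne_zero hs hB h2
    have hv0 : v ≠ 0 := by
      rintro rfl
      simp at hv
    have hspan := (finrank_eq_one_iff_of_nonzero' v hv0).1 hV
    rw [mul_zero, pow_zero, Nat.card_eq_one_iff_exists]
    refine ⟨⟨0, by simp⟩, ?_⟩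
    rintro ⟨x, hx⟩
    obtain ⟨c, rfl⟩ := hspan x
    have : c = 0 := by simpa [hv] using hx
    simp [this]
  | succ n ih =>
    obtain ⟨e, f, h⟩ := exists_isHyperbolicPair hs hB h2 (by lia)
    have hW : finrank F (B.pairCompl e f) = 2 * n + 1 := by
      have := h.finrank_pairCompl hs
      lia
    rw [h.card_isotropic hs h2, ih (hs.restrict _) (h.separatingLeft_restrict hs hB) hW,
      Module.natCard_eq_pow_finrank (K := F) (V := B.pairCompl e f), hW]
    obtain ⟨k, hk⟩ : ∃ k, Nat.card F = k + 1 := ⟨_, (Nat.succ_pred Nat.card_pos.ne').symm⟩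
    rw [hk, Nat.add_sub_cancel]
    ring

/-- The order of the full isometry group in odd dimension. -/
theorem card_isometryGroup_of_odd_finrank {F V : Type*} [Field F] [Finite F] [AddCommGroup V]
    [Module F V] [FiniteDimensional F V] (h2 : (2 : F) ≠ 0) {B : LinearMap.BilinForm F V}
    (hs : B.IsSymm) (hB : B.SeparatingLeft) {n : ℕ} (hV : finrank F V = 2 * n + 1) :
    Nat.card B.isometryGroup = 2 * (Nat.card F ^ (n ^ 2) *
      ∏ i ∈ Finset.range n, (Nat.card F ^ (2 * (i + 1)) - 1)) := by
  induction n generalizing V with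
  | zero =>
    have : Nontrivial V := Module.nontrivial_of_finrank_pos (R := F) (by lia)
    obtain ⟨v, hv⟩ := SeparatingLeft.exists_self_ne_zero hs hB h2
    have hv0 : v ≠ 0 := by
      rintro rfl
      simp at hv
    have hspan := (finrank_eq_one_iff_of_nonzero' v hv0).1 hV
    rw [Nat.card_eq_two_iff' (1 : B.isometryGroup) |>.2]
    · simp
    · refine ⟨⟨LinearEquiv.neg F, fun x y => by simp⟩, fun h1 => ?_, ?_⟩
      · have h3 : -v = v := congrArg (fun g : B.isometryGroup => g.1 v) h1
        have h4 : (2 : F) • v = 0 := by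
          rw [two_smul]
          nth_rewrite 1 [← h3]
          simp
        exact (smul_ne_zero h2 hv0) h4
      · rintro ⟨g, hg⟩ hg1
        obtain ⟨c, hc⟩ := hspan (g v)
        have h3 := hg v v
        rw [← hc] at h3
        have h4 : c * c = 1 := by
          refine mul_right_cancel₀ hv ?_
          simpa [mul_assoc] using h3
        rcases mul_self_eq_one_iff.1 h4 with rfl | rfl
        · refine (hg1 ?_).elim
          ext x
          obtain ⟨d, rfl⟩ := hspan x
          simp [← hc]
        · ext x
          obtain ⟨d, rfl⟩ := hspan x
          simp [← hc]
  | succ n ih =>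
    obtain ⟨e, f, h⟩ := exists_isHyperbolicPair hs hB h2 (by lia)
    have hW : finrank F (B.pairCompl e f) = 2 * n + 1 := by
      have := h.finrank_pairCompl hs
      lia
    rw [h.card_isometryGroup hs h2, ih (hs.restrict _) (h.separatingLeft_restrict hs hB) hW,
      IsHyperbolicPair.card_hyperbolicPairs hs hB h2, card_isotropic_of_odd_finrank h2 hs hB hV,
      hV, Finset.prod_range_succ, show 2 * (n + 1) + 1 - 2 = 2 * n + 1 by lia]
    ring

/-- An isometry of a non-degenerate form has determinant `1` or `-1`. -/
theorem det_mul_self_eq_one {F V : Type*} [Field F] [AddCommGroup V] [Module F V]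
    [FiniteDimensional F V] {B : LinearMap.BilinForm F V} (hB : B.Nondegenerate)
    {g : V →ₗ[F] V} (hg : ∀ v w, B (g v) (g w) = B v w) :
    LinearMap.det g * LinearMap.det g = 1 := by
  classical
  let b := Module.finBasis F V
  have h1 : B.comp g g = B := by
    ext v w
    exact hg v w
  have h2 := congrArg Matrix.det (LinearMap.BilinForm.toMatrix_comp b b B g g)
  have h3 : (LinearMap.BilinForm.toMatrix b B).det ≠ 0 :=
    (LinearMap.BilinForm.nondegenerate_iff_det_ne_zero b).1 hB
  rw [h1, Matrix.det_mul, Matrix.det_mul, Matrix.det_transpose, LinearMap.det_toMatrix] at h2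
  refine mul_right_cancel₀ h3 ?_
  linear_combination -h2

/-- In odd dimension the isometries of determinant `1` have index two in the isometry group. -/
theorem card_isometryGroup_eq_two_mul {F V : Type*} [Field F] [Finite F] [AddCommGroup V]
    [Module F V] [FiniteDimensional F V] (h2 : (2 : F) ≠ 0) {B : LinearMap.BilinForm F V}
    (hB : B.Nondegenerate) (hV : Odd (finrank F V)) :
    Nat.card B.isometryGroup = 2 * Nat.card {g : V →ₗ[F] V //
      (∀ v w, B (g v) (g w) = B v w) ∧ LinearMap.det g = 1} := by
  have hneg (g : V →ₗ[F] V) : LinearMap.det (-g) = -LinearMap.det g := by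
    have := LinearMap.det_smul (-1 : F) g
    simpa [hV.neg_one_pow] using this
  have : Finite V := Module.finite_of_finite F
  have h11 : (-1 : F) ≠ 1 := fun h => h2 (by linear_combination -h)
  have hinj {g : V →ₗ[F] V} (hg : ∀ v w, B (g v) (g w) = B v w) : Function.Injective g := by
    refine (injective_iff_map_eq_zero g).2 fun v hv => hB.1 v fun w => ?_
    rw [← hg, hv]
    simp
  have hinj' {g : V →ₗ[F] V} (hg : ∀ v w, B (g v) (g w) = B v w) : Function.Injective (-g) :=
    hinj fun v w => by simp [hg]
  have : Finite (V →ₗ[F] V) := DFunLike.finite _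
  let S := {g : V →ₗ[F] V // (∀ v w, B (g v) (g w) = B v w) ∧ LinearMap.det g = 1}
  let T : S ⊕ S → B.isometryGroup := Sum.elim
    (fun s => ⟨LinearEquiv.ofInjectiveEndo s.1 (hinj s.2.1), s.2.1⟩)
    (fun s => ⟨LinearEquiv.ofInjectiveEndo (-s.1) (hinj' s.2.1), fun v w => by simp [s.2.1]⟩)
  have hT (s : S ⊕ S) : (T s).1.toLinearMap = Sum.elim (fun s => s.1) (fun s => -s.1) s := by
    rcases s with s | s <;> rfl
  rw [two_mul, ← Nat.card_sum]
  symm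
  refine Nat.card_congr (Equiv.ofBijective T ⟨?_, ?_⟩)
  · intro s t hst
    have := congrArg (fun g : B.isometryGroup => g.1.toLinearMap) hst
    simp only [hT] at this
    rcases s with ⟨s, hs⟩ | ⟨s, hs⟩ <;> rcases t with ⟨t, ht⟩ | ⟨t, ht⟩ <;>
      simp only [Sum.elim_inl, Sum.elim_inr, neg_inj] at this
    · subst this; rfl
    · subst this
      exact (h11 (by rw [← ht.2, ← hneg, hs.2, ht.2])).elim
    · subst this
      exact (h11 (by rw [← hs.2, ← hneg, ht.2, hs.2])).elim
    · subst this; rfl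
  · rintro ⟨g, hg⟩
    rcases mul_self_eq_one_iff.1 (det_mul_self_eq_one hB (g := g.toLinearMap) hg) with h | h
    · exact ⟨Sum.inl ⟨g.toLinearMap, hg, h⟩, by ext; rfl⟩
    · refine ⟨Sum.inr ⟨-g.toLinearMap, fun v w => by simpa using hg v w,
        by rw [hneg, h, neg_neg]⟩, ?_⟩
      ext
      simp [T]

end LinearMap.BilinForm

/-- The order of `SO_{2n+1}(F_q)` for odd `q`:
`q^{n²}(q^{2n}-1)(q^{2n-2}-1)⋯(q²-1)`. -/
theorem stmt3 (n q : ℕ) (F : Type*) [Field F] [Fintype F]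
    (hq : Fintype.card F = q) (hodd : Odd q)
    (B : LinearMap.BilinForm F (Fin (2 * n + 1) → F))
    (hsymm : B.IsSymm) (hnd : B.Nondegenerate) :
    Nat.card {g : (Fin (2 * n + 1) → F) →ₗ[F] (Fin (2 * n + 1) → F) //
        (∀ v w, B (g v) (g w) = B v w) ∧ LinearMap.det g = 1} =
      q ^ (n ^ 2) * ∏ i ∈ Finset.range n, (q ^ (2 * (i + 1)) - 1) := by
  have h2 : (2 : F) ≠ 0 := Ring.two_ne_zero fun hc => by
    have := FiniteField.even_card_iff_char_two.1 hc
    rw [hq, Nat.odd_iff.1 hodd] at this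
    exact one_ne_zero this
  have hV : finrank F (Fin (2 * n + 1) → F) = 2 * n + 1 := by simp
  have h := LinearMap.BilinForm.card_isometryGroup_of_odd_finrank h2 hsymm hnd.1 hV
  rw [LinearMap.BilinForm.card_isometryGroup_eq_two_mul h2 hnd
      (by rw [hV]; exact odd_two_mul_add_one n),
    Nat.card_eq_fintype_card (α := F), hq] at h
  exact Nat.eq_of_mul_eq_mul_left two_pos h
end

section
/- Let $p$ be an odd prime, $f(x) \in \mathbb{Z}_p[x]$ monic of degree $2n+1$ with nonzero discriminant, and suppose the order $R = \mathbb{Z}_p[x]/(f(x))$ is the maximal order in $L = \mathbb{Q}_p[x]/(f(x))$. Write $L = \prod_i L_i$ as a product of fields with $\beta_i$ the image of $x$ in $L_i$. Then for any $a, b \in \mathbb{Q}_p$ with $b^2 = f(a)$ and $b \neq 0$, the valuation $v_{L_i}(a - \beta_i)$ is even for every $i$. -/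
open Polynomial

/-- If `π² ∣ f(a)` and `π ∣ f'(a)` for a prime element `π`, then `R[x] ≅ R[X]/(f)` is not
integrally closed in any algebra in which `π` is invertible. -/
theorem not_integralClosure_le_adjoin_of_sq_dvd_eval {R A : Type*} [CommRing R]
    [CommRing A] [Algebra R A] {f : R[X]} (hf : f.Monic) {x : A} (hx : aeval x f = 0)
    (hker : ∀ h : R[X], aeval x h = 0 → f ∣ h) {π a : R} (hπ : Prime π) {ϖ : A}
    (hϖ : algebraMap R A π * ϖ = 1) (h0 : π ^ 2 ∣ f.eval a) (h1 : π ∣ f.derivative.eval a) :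
    ¬ integralClosure R A ≤ Algebra.adjoin R {x} := by
  intro hle
  obtain ⟨k, hk⟩ := X_sub_C_dvd_sub_C_eval (a := a) (p := f)
  obtain ⟨q, hq⟩ := X_sub_C_dvd_sub_C_eval (a := a) (p := k)
  have hka : f.derivative.eval a = k.eval a := by
    have := congrArg (fun t => (derivative t).eval a) hk
    simpa [derivative_mul] using this
  obtain ⟨e, he⟩ := h0
  obtain ⟨d, hd⟩ := h1
  rw [hd] at hka
  rw [he] at hk
  rw [← hka] at hq
  have hfq : f = C (π ^ 2 * e) + C (π * d) * (X - C a) + (X - C a) ^ 2 * q := by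
    linear_combination hk + (X - C a) * hq
  have hxint : IsIntegral R x := ⟨f, hf, hx⟩
  set w : A := ϖ * aeval x ((X - C a) * q) with hw
  have hwint : IsIntegral R w := by
    refine IsIntegral.of_aeval_monic (p := X ^ 2 + C d * X) (by monicity!) ?_ ?_
    · have : Nontrivial R := ⟨π, 0, hπ.ne_zero⟩
      have : (X ^ 2 + C d * X).natDegree = 2 := by compute_degree!
      omega
    · have : aeval w (X ^ 2 + C d * X) = - aeval x (C e * q) := by
        have h2 : aeval x (C (π ^ 2 * e) + C (π * d) * (X - C a) + (X - C a) ^ 2 * q) = 0 := by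
          rw [← hfq, hx]
        simp only [map_add, map_mul, map_pow, map_sub, aeval_X, aeval_C] at h2 ⊢
        rw [hw]
        simp only [map_mul, map_sub, aeval_X, aeval_C]
        generalize algebraMap R A π = P at *
        generalize algebraMap R A a = a' at *
        generalize algebraMap R A d = d' at *
        generalize algebraMap R A e = e' at *
        generalize aeval x q = q' at *
        linear_combination ϖ ^ 2 * q' * h2 - (ϖ * (x - a') * q' * d' + (P * ϖ + 1) * e' * q') * hϖ
      rw [this]
      refine IsIntegral.neg ?_
      exact adjoin_le_integralClosure hxint (aeval_mem_adjoin_singleton R x)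
  have hwmem := hle hwint
  rw [Algebra.adjoin_singleton_eq_range_aeval] at hwmem
  obtain ⟨r, hr⟩ := hwmem
  obtain ⟨s, hs⟩ := hker ((X - C a) * q - C π * r) (by
    have hr' : aeval x r = w := hr
    rw [map_sub, map_mul (aeval x) (C π), hr', hw, aeval_C]
    linear_combination (- aeval x ((X - C a) * q)) * hϖ)
  have := (Ideal.span_singleton_prime hπ.ne_zero).mpr hπ
  set φ := Ideal.Quotient.mk (Ideal.span {π})
  have hφπ : φ π = 0 := Ideal.Quotient.eq_zero_iff_mem.mpr (Ideal.mem_span_singleton_self π)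
  have hf' := congrArg (map φ) hfq
  have hs' := congrArg (map φ) hs
  simp only [Polynomial.map_add, Polynomial.map_sub, Polynomial.map_mul, Polynomial.map_pow,
    map_C, map_X, hφπ, map_mul, map_pow, C_0, zero_mul, sub_zero, zero_add, ne_eq,
    OfNat.ofNat_ne_zero, not_false_eq_true, zero_pow] at hf' hs'
  have hne : (X - C (φ a)) * map φ q ≠ 0 := by
    intro h
    refine (hf.map φ).ne_zero ?_
    rw [hf', pow_two, mul_assoc, h, mul_zero]
  have h1 : (1 : (R ⧸ Ideal.span {π})[X]) = (X - C (φ a)) * map φ s := by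
    refine mul_left_cancel₀ hne ?_
    rw [hf'] at hs'
    linear_combination hs'
  simpa using congrArg (eval (φ a)) h1

/-- If `h(β) = 0` and `h(a)` is a unit, then `a - β` is a unit with integral inverse. -/
theorem exists_isIntegral_mul_eq_one_of_isUnit_eval {R E : Type*} [CommRing R] [CommRing E]
    [Algebra R E] {h : R[X]} {β : E} (hβ : aeval β h = 0) (hint : IsIntegral R β) {a : R}
    (ha : IsUnit (h.eval a)) :
    ∃ v : E, (algebraMap R E a - β) * v = 1 ∧ IsIntegral R v := by
  obtain ⟨k, hk⟩ := X_sub_C_dvd_sub_C_eval (a := a) (p := h)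
  obtain ⟨c, hc⟩ := ha.exists_right_inv
  have hk' := congrArg (aeval β) hk
  simp only [map_sub, map_mul, aeval_X, aeval_C, hβ] at hk'
  have hc' := congrArg (algebraMap R E) hc
  simp only [map_mul, map_one] at hc'
  refine ⟨aeval β (C c * k), ?_, adjoin_le_integralClosure hint (aeval_mem_adjoin_singleton R β)⟩
  simp only [map_mul, aeval_C]
  linear_combination hc' + algebraMap R E c * hk'

/-- If `c` is a non-unit of a local ring and `f` is monic, then the scaled
polynomial `c ^ deg f * f (X / c)` takes a unit value at `1`. -/
theorem Polynomial.Monic.isUnit_eval_one_scaleRoots {R : Type*} [CommRing R] [IsLocalRing R]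
    {f : R[X]} (hf : f.Monic) {c : R} (hc : ¬ IsUnit c) : IsUnit ((f.scaleRoots c).eval 1) := by
  rw [← IsLocalRing.notMem_maximalIdeal, ← IsLocalRing.residue_eq_zero_iff, ← ne_eq]
  have hc0 : IsLocalRing.residue R c = 0 := by
    rwa [IsLocalRing.residue_eq_zero_iff, IsLocalRing.mem_maximalIdeal]
  have h := map_scaleRoots f c (IsLocalRing.residue R) (by simp [hf.leadingCoeff])
  rw [hc0, scaleRoots_zero, (hf.map _).leadingCoeff, one_smul] at h
  have h' := congrArg (eval (IsLocalRing.residue R 1)) h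
  rw [eval_map_apply] at h'
  rw [h']
  simp

open Polynomial

/-- Let `p` be odd, `f ∈ ℤ_p[x]` monic of degree `2n+1` with nonzero discriminant
(i.e. separable over `ℚ_p`), and suppose the order `ℤ_p[x]/(f)` is the maximal order
in `L = ℚ_p[x]/(f)`. Then for any `a, b ∈ ℚ_p` with `b² = f(a)` and `b ≠ 0`, and any
field factor `L_i = ℚ_p[x]/(g)` of `L` (`g` a monic irreducible factor of `f`), the
valuation of `a - β_i` in `L_i` is even; equivalently `a - β_i` is a unit of the ring
of integers times a square. -/
theorem stmt14 (p : ℕ) [Fact p.Prime] (hp : p ≠ 2) (n : ℕ)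
    (f : Polynomial ℤ_[p]) (hf : f.Monic) (hdeg : f.natDegree = 2 * n + 1)
    (F : Polynomial ℚ_[p]) (hF : F = f.map (algebraMap ℤ_[p] ℚ_[p]))
    (hsep : F.Separable)
    (hmax : Algebra.adjoin ℤ_[p] {AdjoinRoot.root F} =
      integralClosure ℤ_[p] (AdjoinRoot F))
    (a b : ℚ_[p]) (hb : b ≠ 0) (hab : b ^ 2 = Polynomial.eval a F)
    (g : Polynomial ℚ_[p]) (hg : Irreducible g) (hgm : g.Monic) (hdvd : g ∣ F) :
    ∃ z u v : AdjoinRoot g,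
      algebraMap ℚ_[p] (AdjoinRoot g) a - AdjoinRoot.root g = u * z ^ 2 ∧
      u * v = 1 ∧ IsIntegral ℤ_[p] u ∧ IsIntegral ℤ_[p] v := by
  have hβF : aeval (AdjoinRoot.root g) F = 0 := by
    rw [AdjoinRoot.aeval_eq, AdjoinRoot.mk_eq_zero]
    exact hdvd
  have := Fact.mk hg
  set β := AdjoinRoot.root g
  have hβ : aeval β f = 0 := by
    rwa [hF, aeval_map_algebraMap] at hβF
  have hβint : IsIntegral ℤ_[p] β := ⟨f, hf, hβ⟩
  by_cases ha : ‖a‖ ≤ 1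
  · obtain ⟨a, rfl⟩ : ∃ a' : ℤ_[p], algebraMap ℤ_[p] ℚ_[p] a' = a := ⟨⟨a, ha⟩, rfl⟩
    rw [← IsScalarTower.algebraMap_apply ℤ_[p] ℚ_[p] (AdjoinRoot g)]
    rw [hF, eval_map_algebraMap, aeval_algebraMap_apply, coe_aeval_eq_eval] at hab
    have key : ∀ h : ℤ_[p][X], aeval β h = 0 → IsUnit (h.eval a) →
        ∃ z u v : AdjoinRoot g, algebraMap ℤ_[p] (AdjoinRoot g) a - β = u * z ^ 2 ∧
          u * v = 1 ∧ IsIntegral ℤ_[p] u ∧ IsIntegral ℤ_[p] v := by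
      intro h h0 hu
      obtain ⟨v, hv, hvi⟩ := exists_isIntegral_mul_eq_one_of_isUnit_eval h0 hβint hu
      exact ⟨1, _, v, by ring, hv, isIntegral_algebraMap.sub hβint, hvi⟩
    by_cases hu : IsUnit (f.eval a)
    · exact key f hβ hu
    have hb1 : ‖b‖ ≤ 1 := by
      have : ‖b‖ ^ 2 ≤ 1 := by
        rw [← norm_pow, hab]
        exact PadicInt.norm_le_one _
      exact (pow_le_one_iff_of_nonneg (norm_nonneg b) two_ne_zero).mp this
    obtain ⟨b, rfl⟩ : ∃ b' : ℤ_[p], algebraMap ℤ_[p] ℚ_[p] b' = b := ⟨⟨b, hb1⟩, rfl⟩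
    rw [← map_pow] at hab
    replace hab := IsFractionRing.injective ℤ_[p] ℚ_[p] hab
    have hbp : (p : ℤ_[p]) ∣ b := by
      rw [← PadicInt.norm_lt_one_iff_dvd, ← PadicInt.not_isUnit_iff]
      intro h
      exact hu (hab ▸ h.pow 2)
    have hd : IsUnit (f.derivative.eval a) := by
      by_contra hd
      rw [PadicInt.not_isUnit_iff, PadicInt.norm_lt_one_iff_dvd] at hd
      have hp0 : (p : ℚ_[p]) ≠ 0 := Nat.cast_ne_zero.mpr (Fact.out : p.Prime).ne_zero
      refine not_integralClosure_le_adjoin_of_sq_dvd_eval (A := AdjoinRoot F) hf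
        (x := AdjoinRoot.root F) ?_ ?_ PadicInt.prime_p
        (ϖ := algebraMap ℚ_[p] (AdjoinRoot F) (p : ℚ_[p])⁻¹) ?_ (hab ▸ pow_dvd_pow_of_dvd hbp 2)
        hd hmax.ge
      · rw [← aeval_map_algebraMap ℚ_[p], ← hF, AdjoinRoot.aeval_eq, AdjoinRoot.mk_self]
      · intro h hh
        rw [← aeval_map_algebraMap ℚ_[p], AdjoinRoot.aeval_eq, AdjoinRoot.mk_eq_zero, hF] at hh
        exact (map_dvd_map _ (IsFractionRing.injective ℤ_[p] ℚ_[p]) hf).mp hh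
      · rw [IsScalarTower.algebraMap_apply ℤ_[p] ℚ_[p] (AdjoinRoot F), ← map_mul, map_natCast,
          mul_inv_cancel₀ hp0, map_one]
    have hd1 := PadicInt.isUnit_iff.mp hd
    obtain ⟨α, hα, hαa, -, -⟩ := hensels_lemma (p := p) (F := f) (a := a) (by
      simp only [coe_aeval_eq_eval]
      rw [hd1, one_pow]
      exact PadicInt.not_isUnit_iff.mp hu)
    simp only [coe_aeval_eq_eval] at hα hαa
    rw [hd1] at hαa
    obtain ⟨h, rfl⟩ := dvd_iff_isRoot.mpr hα
    have hha : IsUnit (h.eval a) := by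
      by_contra hn
      refine PadicInt.not_isUnit_iff.mpr ?_ hd
      simp only [derivative_mul, derivative_X_sub_C, one_mul, eval_add, eval_mul, eval_sub,
        eval_X, eval_C]
      refine PadicInt.norm_lt_one_add (PadicInt.not_isUnit_iff.mp hn) ?_
      rw [mul_comm]
      refine PadicInt.norm_lt_one_mul ?_
      rwa [norm_sub_rev]
    rw [map_mul, mul_eq_zero] at hβ
    rcases hβ with hβ | hβ
    · obtain ⟨c, hc⟩ := hha.exists_right_inv
      simp only [map_sub, aeval_X, aeval_C, sub_eq_zero] at hβ
      simp only [eval_mul, eval_sub, eval_X, eval_C] at hab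
      refine ⟨algebraMap _ _ b, algebraMap _ _ c, algebraMap _ _ (h.eval a), ?_, ?_,
        isIntegral_algebraMap, isIntegral_algebraMap⟩
      · rw [hβ, ← map_sub, ← map_pow, ← map_mul]
        congr 1
        linear_combination (-(a - α)) * hc - c * hab
      · rw [← map_mul, mul_comm, hc, map_one]
    · exact key h hβ hha
  · push Not at ha
    have ha0 : a ≠ 0 := by
      rintro rfl
      simp at ha
      linarith
    have hc1 : ‖a⁻¹‖ < 1 := by
      rw [norm_inv]
      exact inv_lt_one_of_one_lt₀ ha
    obtain ⟨c, hc⟩ : ∃ c : ℤ_[p], algebraMap ℤ_[p] ℚ_[p] c = a⁻¹ := ⟨⟨a⁻¹, hc1.le⟩, rfl⟩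
    have hcu : ¬ IsUnit c := by
      rw [PadicInt.not_isUnit_iff]
      change ‖algebraMap ℤ_[p] ℚ_[p] c‖ < 1
      rwa [hc]
    have hu := hf.isUnit_eval_one_scaleRoots hcu
    obtain ⟨v, hv, hvi⟩ := exists_isIntegral_mul_eq_one_of_isUnit_eval
      (scaleRoots_aeval_eq_zero (r := c) hβ) (isIntegral_algebraMap.mul hβint) hu
    have he : algebraMap ℤ_[p] ℚ_[p] ((f.scaleRoots c).eval 1) =
        algebraMap ℤ_[p] ℚ_[p] c ^ (2 * n + 1) * b ^ 2 := by
      have h := scaleRoots_eval₂_mul (p := f) (algebraMap ℤ_[p] ℚ_[p]) a c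
      rw [hc, inv_mul_cancel₀ ha0, hdeg, ← eval_map, ← eval_map, ← hF, ← hab] at h
      rw [hc, ← h, ← eval_map_apply, map_one]
    obtain ⟨d, hd⟩ := hu.exists_right_inv
    generalize (f.scaleRoots c).eval 1 = e at *
    have had : a = algebraMap ℤ_[p] ℚ_[p] d * (algebraMap ℤ_[p] ℚ_[p] c ^ n * b) ^ 2 := by
      have hd' := congrArg (algebraMap ℤ_[p] ℚ_[p]) hd
      rw [map_mul, map_one, he, hc] at hd'
      rw [hc]
      have : a * a⁻¹ = 1 := mul_inv_cancel₀ ha0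
      linear_combination (-a) * hd' + (algebraMap ℤ_[p] ℚ_[p] d * (a⁻¹ ^ n * b) ^ 2) * this
    have hcE : algebraMap ℚ_[p] (AdjoinRoot g) a * algebraMap ℤ_[p] (AdjoinRoot g) c = 1 := by
      rw [IsScalarTower.algebraMap_apply ℤ_[p] ℚ_[p] (AdjoinRoot g), ← map_mul, hc,
        mul_inv_cancel₀ ha0, map_one]
    have hadE := congrArg (algebraMap ℚ_[p] (AdjoinRoot g)) had
    rw [map_mul, ← IsScalarTower.algebraMap_apply, map_pow _ _ 2] at hadE
    have hdE := congrArg (algebraMap ℤ_[p] (AdjoinRoot g)) hd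
    rw [map_mul, map_one] at hdE
    rw [map_one] at hv
    set z := algebraMap ℚ_[p] (AdjoinRoot g) (algebraMap ℤ_[p] ℚ_[p] c ^ n * b)
    refine ⟨z, algebraMap _ _ d * (1 - algebraMap _ _ c * β), algebraMap _ _ e * v, ?_, ?_,
      isIntegral_algebraMap.mul (isIntegral_one.sub (isIntegral_algebraMap.mul hβint)),
      isIntegral_algebraMap.mul hvi⟩
    · linear_combination (1 - algebraMap ℤ_[p] (AdjoinRoot g) c * β) * hadE + β * hcE
    · linear_combination hdE + algebraMap ℤ_[p] (AdjoinRoot g) e *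
        algebraMap ℤ_[p] (AdjoinRoot g) d * hv
end
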